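/- Let 0 < q < 1 be a real number. Then for every M > 0 there exists a nonempty bounded open set Ω ⊆ ℝ^d with Lebesgue measure |Ω| = 1 such that λ∞(Ω) · T∞(Ω)^q ≥ M. In other words, the supremum of λ∞(Ω) T∞(Ω)^q over all bounded open sets of unit measure is +∞. -/

import Mathlib

open MeasureTheory Metric Set

noncomputable def dirichletEigenvalue (d : ℕ) (Ω : Set (EuclideanSpace ℝ (Fin d))) : ℝ :=
  sInf { t : ℝ | ∃ u : EuclideanSpace ℝ (Fin d) → ℝ, ContDiff ℝ (⊤ : ℕ∞) u ∧
    HasCompactSupport u ∧ tsupport u ⊆ Ω ∧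
    (0 < ∫ x in Ω, (u x) ^ 2) ∧
    t = (∫ x in Ω, ‖fderiv ℝ u x‖ ^ 2) / ∫ x in Ω, (u x) ^ 2 }

noncomputable def dirichletTorsion (d : ℕ) (Ω : Set (EuclideanSpace ℝ (Fin d))) : ℝ :=
  sSup { t : ℝ | ∃ u : EuclideanSpace ℝ (Fin d) → ℝ, ContDiff ℝ (⊤ : ℕ∞) u ∧
    HasCompactSupport u ∧ tsupport u ⊆ Ω ∧
    (0 < ∫ x in Ω, ‖fderiv ℝ u x‖ ^ 2) ∧
    t = (∫ x in Ω, u x) ^ 2 / ∫ x in Ω, ‖fderiv ℝ u x‖ ^ 2 }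


def slabSet (d : ℕ) (i : Fin d) (N : ℕ) : Set (EuclideanSpace ℝ (Fin d)) :=
  {x | (∀ j, x j ∈ Ioo (0 : ℝ) 1) ∧ (N : ℝ) * x i ∉ range ((↑) : ℤ → ℝ)}

lemma slab_coord_cont (d : ℕ) (j : Fin d) : Continuous (fun x : EuclideanSpace ℝ (Fin d) => x j) := by
  fun_prop

lemma slab_open (d : ℕ) (i : Fin d) (N : ℕ) : IsOpen (slabSet d i N) := by
  have h1 : IsOpen {x : EuclideanSpace ℝ (Fin d) | ∀ j, x j ∈ Ioo (0 : ℝ) 1} := by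
    rw [ofPred_forall]
    exact isOpen_iInter_of_finite fun j => isOpen_Ioo.preimage (slab_coord_cont d j)
  have h2 : IsOpen {x : EuclideanSpace ℝ (Fin d) | (N : ℝ) * x i ∉ range ((↑) : ℤ → ℝ)} := by
    have : IsClosed (range ((↑) : ℤ → ℝ)) := Int.isClosedEmbedding_coe_real.isClosed_range
    exact this.isOpen_compl.preimage (continuous_const.mul (slab_coord_cont d i))
  exact h1.inter h2

lemma slab_volume (d : ℕ) (i : Fin d) (N : ℕ) (hN : 0 < N) : volume (slabSet d i N) = 1 := by
  have hN' : (N : ℝ) ≠ 0 := by positivity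
  let S : Set (Fin d → ℝ) := {y | (∀ j, y j ∈ Ioo (0 : ℝ) 1) ∧ (N : ℝ) * y i ∉ range ((↑) : ℤ → ℝ)}
  have e : slabSet d i N = (WithLp.ofLp) ⁻¹' S := rfl
  have hae : S =ᵐ[volume] (Set.pi univ fun _ : Fin d => Ioo (0 : ℝ) 1) := by
    have : ∀ k : ℤ, ∀ᵐ y : Fin d → ℝ, y i ≠ (k : ℝ) / N := fun k =>
      Measure.ae_eval_ne (fun _ => volume) i _
    rw [← ae_all_iff] at this
    filter_upwards [this] with y hy
    apply propext
    constructor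
    · intro h j _
      exact h.1 j
    · intro h
      refine ⟨fun j => h j (mem_univ j), ?_⟩
      rintro ⟨k, hk⟩
      apply hy k
      rw [hk]; field_simp
  have hS : volume S = 1 := by
    rw [measure_congr hae, Real.volume_pi_Ioo]
    simp
  have hSn : NullMeasurableSet S volume :=
    ((MeasurableSet.univ_pi fun _ => measurableSet_Ioo).nullMeasurableSet).congr hae.symm
  rw [e, (PiLp.volume_preserving_ofLp (Fin d)).measure_preimage hSn, hS]

lemma slab_bounded (d : ℕ) (i : Fin d) (N : ℕ) : Bornology.IsBounded (slabSet d i N) := by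
  rw [isBounded_iff_forall_norm_le]
  refine ⟨√d, fun x hx => ?_⟩
  rw [EuclideanSpace.norm_eq]
  apply Real.sqrt_le_sqrt
  calc ∑ j, ‖x j‖ ^ 2 ≤ ∑ j : Fin d, (1 : ℝ) := by
        apply Finset.sum_le_sum
        intro j _
        have := hx.1 j
        rw [Real.norm_eq_abs, sq_abs]
        nlinarith [this.1, this.2]
    _ = d := by simp

lemma integrable_sq_aux (d : ℕ) (u : EuclideanSpace ℝ (Fin d) → ℝ)
    (hu : Continuous u) (hc : HasCompactSupport u) : Integrable (fun x => u x ^ 2) := by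
  have h : HasCompactSupport (fun x => u x ^ 2) := by
    have : (fun x => u x ^ 2) = (fun x => u x * u x) := by
      funext x; ring
    rw [this]
    exact hc.mul_right
  exact (hu.pow 2).integrable_of_hasCompactSupport h

lemma slab_poincare (d : ℕ) (i : Fin d) (N : ℕ) (hN : 0 < N) (u : EuclideanSpace ℝ (Fin d) → ℝ)
    (hu : ContDiff ℝ (⊤ : ℕ∞) u) (hc : HasCompactSupport u) (hs : tsupport u ⊆ slabSet d i N) :
    (∫ x in slabSet d i N, (u x) ^ 2) ≤
      4 / (N : ℝ) ^ 2 * ∫ x in slabSet d i N, ‖fderiv ℝ u x‖ ^ 2 := by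
  have hN' : (0 : ℝ) < N := by positivity
  have hz : ∀ x, x ∉ slabSet d i N → u x = 0 := fun x hx =>
    image_eq_zero_of_notMem_tsupport fun h => hx (hs h)
  have hz' : ∀ x, x ∉ slabSet d i N → fderiv ℝ u x = 0 := fun x hx =>
    image_eq_zero_of_notMem_tsupport fun h => hx (hs (tsupport_fderiv_subset ℝ h))
  rw [setIntegral_eq_integral_of_forall_compl_eq_zero (fun x hx => by simp [hz x hx]),
    setIntegral_eq_integral_of_forall_compl_eq_zero (fun x hx => by simp [hz' x hx])]
  have hd : Differentiable ℝ u := hu.differentiable (by simp)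
  have hcf : Continuous (fderiv ℝ u) := hu.continuous_fderiv (by simp)
  have hccf : HasCompactSupport (fderiv ℝ u) := hc.fderiv ℝ
  set v : EuclideanSpace ℝ (Fin d) := EuclideanSpace.single i 1 with hv
  have hvn : ‖v‖ = 1 := by simp [hv]
  let G : EuclideanSpace ℝ (Fin d) → ℝ := fun x => Int.fract ((N : ℝ) * x i)
  have hGm : Measurable G :=
    measurable_fract.comp (continuous_const.mul (slab_coord_cont d i)).measurable
  have hG1 : ∀ x, ‖G x‖ ≤ 1 := fun x => by
    rw [Real.norm_eq_abs, abs_of_nonneg (Int.fract_nonneg _)]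
    exact (Int.fract_lt_one _).le
  have hGd : ∀ x ∈ slabSet d i N,
      HasFDerivAt G ((N : ℝ) • (EuclideanSpace.proj i : EuclideanSpace ℝ (Fin d) →L[ℝ] ℝ)) x := by
    intro x hx
    have h0 : HasFDerivAt (fun x : EuclideanSpace ℝ (Fin d) => (N : ℝ) * x i - ⌊(N : ℝ) * x i⌋)
        ((N : ℝ) • (EuclideanSpace.proj i : EuclideanSpace ℝ (Fin d) →L[ℝ] ℝ)) x := by
      have h1 : HasFDerivAt (fun x : EuclideanSpace ℝ (Fin d) => (N : ℝ) * x i)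
          ((N : ℝ) • (EuclideanSpace.proj i : EuclideanSpace ℝ (Fin d) →L[ℝ] ℝ)) x :=
        ((EuclideanSpace.proj i : EuclideanSpace ℝ (Fin d) →L[ℝ] ℝ).hasFDerivAt).const_mul _
      have h2 : (fun y : EuclideanSpace ℝ (Fin d) => (N : ℝ) * y i - ⌊(N : ℝ) * y i⌋) =ᶠ[nhds x]
          (fun y : EuclideanSpace ℝ (Fin d) => (N : ℝ) * y i - ⌊(N : ℝ) * x i⌋) := by
        have hlt : ((⌊(N : ℝ) * x i⌋ : ℤ) : ℝ) < (N : ℝ) * x i :=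
          lt_of_le_of_ne (Int.floor_le _) (fun h => hx.2 ⟨_, h⟩)
        have hgt := Int.lt_floor_add_one ((N : ℝ) * x i)
        have hcont : Continuous (fun y : EuclideanSpace ℝ (Fin d) => (N : ℝ) * y i) :=
          continuous_const.mul (slab_coord_cont d i)
        filter_upwards [(hcont.tendsto x).eventually (lt_mem_nhds hlt),
          (hcont.tendsto x).eventually (gt_mem_nhds hgt)] with y hy1 hy2
        have : ⌊(N : ℝ) * y i⌋ = ⌊(N : ℝ) * x i⌋ := Int.floor_eq_iff.2 ⟨hy1.le, hy2⟩
        rw [this]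
      exact (h1.sub_const _).congr_of_eventuallyEq h2
    exact h0
  have i2 : Integrable (fun x => u x ^ 2) :=
    integrable_sq_aux d u hu.continuous hc
  have iD : Integrable (fun x => ‖fderiv ℝ u x‖ ^ 2) :=
    integrable_sq_aux d (fun x => ‖fderiv ℝ u x‖) hcf.norm hccf.norm
  have icross : Integrable (fun x => u x * fderiv ℝ u x v) :=
    (hu.continuous.mul (hcf.clm_apply continuous_const)).integrable_of_hasCompactSupport hc.mul_right
  have hfd : ∀ x, fderiv ℝ (fun x => u x ^ 2) x v = 2 * (u x * fderiv ℝ u x v) := by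
    intro x
    rw [((hd x).hasFDerivAt.pow 2).fderiv]
    simp; ring
  have hprod : ∀ x, u x ^ 2 * fderiv ℝ G x v = N * u x ^ 2 := by
    intro x
    by_cases hx : x ∈ slabSet d i N
    · rw [(hGd x hx).fderiv]
      simp [hv]; ring
    · simp [hz x hx]
  have icG : Integrable (fun x => G x * (u x * fderiv ℝ u x v)) :=
    icross.bdd_mul hGm.aestronglyMeasurable (Filter.Eventually.of_forall hG1)
  have key := integral_mul_fderiv_eq_neg_fderiv_mul_of_integrable (μ := volume)
    (f := fun x => u x ^ 2) (g := G) (v := v)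
    (by simp_rw [hfd]
        convert icG.const_mul 2 using 2
        ring)
    (by simp_rw [hprod]; exact i2.const_mul _)
    (by simpa [mul_comm] using i2.bdd_mul hGm.aestronglyMeasurable (Filter.Eventually.of_forall hG1))
    (fun x _ => (hd x).pow 2)
    (fun x hx => (hGd x (hs (closure_mono (fun y hy => by
      simp only [Function.mem_support] at hy ⊢
      intro h; apply hy; simp [h]) hx))).differentiableAt)
  simp_rw [hprod, hfd] at key
  rw [integral_const_mul, ← integral_neg] at key
  have hle : ∫ x, -(2 * (u x * fderiv ℝ u x v) * G x) ≤
      ∫ x, ((N : ℝ) / 2 * u x ^ 2 + 2 / N * ‖fderiv ℝ u x‖ ^ 2) := by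
    apply integral_mono
    · apply Integrable.neg
      convert icG.const_mul 2 using 2
      ring
    · exact (i2.const_mul _).add (iD.const_mul _)
    · intro x
      have h1 : |fderiv ℝ u x v| ≤ ‖fderiv ℝ u x‖ := by
        have := (fderiv ℝ u x).le_opNorm v
        rwa [hvn, mul_one] at this
      have h2 := hG1 x
      rw [Real.norm_eq_abs] at h2
      have h3 : |u x * fderiv ℝ u x v * G x| ≤ |u x| * ‖fderiv ℝ u x‖ := by
        rw [abs_mul, abs_mul]
        calc |u x| * |fderiv ℝ u x v| * |G x| ≤ |u x| * ‖fderiv ℝ u x‖ * 1 := by gcongr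
          _ = _ := mul_one _
      have h4 : 2 * (|u x| * ‖fderiv ℝ u x‖) ≤
          (N : ℝ) / 2 * |u x| ^ 2 + 2 / N * ‖fderiv ℝ u x‖ ^ 2 := by
        have h5 : (N : ℝ) / 2 * |u x| ^ 2 + 2 / N * ‖fderiv ℝ u x‖ ^ 2 - 2 * (|u x| * ‖fderiv ℝ u x‖)
          = (N : ℝ) / 2 * (|u x| - 2 / N * ‖fderiv ℝ u x‖) ^ 2 := by
          field_simp; ring
        have : 0 ≤ (N : ℝ) / 2 * (|u x| - 2 / N * ‖fderiv ℝ u x‖) ^ 2 := by positivity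
        linarith
      rw [sq_abs] at h4
      have := (abs_le.1 h3).1
      simp only
      linarith
  rw [← key, integral_add (i2.const_mul _) (iD.const_mul _), integral_const_mul,
    integral_const_mul] at hle
  set A := ∫ x, u x ^ 2
  set D := ∫ x, ‖fderiv ℝ u x‖ ^ 2
  have h6 : (N : ℝ) / 2 * A ≤ 2 / N * D := by linarith
  calc A = 2 / N * ((N : ℝ) / 2 * A) := by field_simp
    _ ≤ 2 / N * (2 / N * D) := by gcongr
    _ = _ := by field_simp; ring

lemma slab_cs (d : ℕ) (i : Fin d) (N : ℕ) (hN : 0 < N) (u : EuclideanSpace ℝ (Fin d) → ℝ)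
    (hu : ContDiff ℝ (⊤ : ℕ∞) u) (hc : HasCompactSupport u) :
    (∫ x in slabSet d i N, u x) ^ 2 ≤ ∫ x in slabSet d i N, (u x) ^ 2 := by
  have hp : IsProbabilityMeasure (volume.restrict (slabSet d i N)) :=
    ⟨by rw [Measure.restrict_apply_univ, slab_volume d i N hN]⟩
  have i1 : Integrable u (volume.restrict (slabSet d i N)) :=
    (hu.continuous.integrable_of_hasCompactSupport hc).restrict
  have i2 : Integrable (fun x => u x ^ 2) (volume.restrict (slabSet d i N)) :=
    (integrable_sq_aux d u hu.continuous hc).restrict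
  set m := ∫ x in slabSet d i N, u x with hm
  have h : 0 ≤ ∫ x in slabSet d i N, (u x ^ 2 - 2 * m * u x + m ^ 2) :=
    integral_nonneg fun x => by
      have := sq_nonneg (u x - m)
      simp only [Pi.zero_apply]
      nlinarith
  have i3 : Integrable (fun x => u x ^ 2 - 2 * m * u x) (volume.restrict (slabSet d i N)) :=
    i2.sub (i1.const_mul _)
  rw [integral_add i3 (integrable_const _),
    integral_sub i2 (i1.const_mul _), integral_const_mul, ← hm] at h
  simp at h
  nlinarith

lemma exists_phi : ∃ (φ : ℝ → ℝ) (K c : ℝ), ContDiff ℝ (⊤ : ℕ∞) φ ∧ (∀ t, 0 ≤ φ t) ∧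
    (∀ t, φ t ≤ 1) ∧ (∀ t, |deriv φ t| ≤ K) ∧ 0 < c ∧ (∀ t, c ≤ φ t + φ (t + 1 / 2)) ∧
    (∀ t ∈ tsupport φ, t ∉ range ((↑) : ℤ → ℝ)) := by
  let h : ℝ → ℝ := fun y => Real.smoothTransition (1 / 2 - y)
  have hh : ContDiff ℝ (⊤ : ℕ∞) h := Real.smoothTransition.contDiff.comp (by fun_prop)
  have hcos : ContDiff ℝ (⊤ : ℕ∞) (fun t : ℝ => Real.cos (2 * Real.pi * t)) := by fun_prop
  have hhc : Continuous (deriv h) := hh.continuous_deriv (by simp)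
  obtain ⟨C, hC⟩ := isCompact_Icc.exists_bound_of_continuousOn (s := Icc (-1 : ℝ) 1)
    hhc.continuousOn
  refine ⟨fun t => h (Real.cos (2 * Real.pi * t)), C * (2 * Real.pi),
    Real.smoothTransition (1 / 2), hh.comp hcos, fun t => Real.smoothTransition.nonneg _,
    fun t => Real.smoothTransition.le_one _, ?_, Real.smoothTransition.pos_of_pos (by norm_num),
    ?_, ?_⟩
  · intro t
    have h1 : HasDerivAt (fun t : ℝ => 2 * Real.pi * t) (2 * Real.pi) t := by
      simpa using (hasDerivAt_id t).const_mul (2 * Real.pi)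
    have h2 := ((hh.differentiable (by simp) _).hasDerivAt.comp t h1.cos)
    have h3 : deriv (fun t => h (Real.cos (2 * Real.pi * t))) t = _ := h2.deriv
    rw [h3, abs_mul, abs_mul, abs_neg]
    have h4 := hC (Real.cos (2 * Real.pi * t)) ⟨Real.neg_one_le_cos _, Real.cos_le_one _⟩
    rw [Real.norm_eq_abs] at h4
    have h5 := Real.abs_sin_le_one (2 * Real.pi * t)
    have h6 : |2 * Real.pi| = 2 * Real.pi := abs_of_pos (by positivity)
    rw [h6]
    have hC0 : 0 ≤ C := (abs_nonneg _).trans h4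
    calc _ ≤ C * (1 * (2 * Real.pi)) := by gcongr
      _ = _ := by ring
  · intro t
    have e : Real.cos (2 * Real.pi * (t + 1 / 2)) = - Real.cos (2 * Real.pi * t) := by
      rw [← Real.cos_add_pi]; congr 1; ring
    simp only [h, e]
    rcases le_total (Real.cos (2 * Real.pi * t)) 0 with h0 | h0
    · have := Real.smoothTransition.monotone
        (show (1 / 2 : ℝ) ≤ 1 / 2 - Real.cos (2 * Real.pi * t) by linarith)
      have h1 := Real.smoothTransition.nonneg (1 / 2 - -Real.cos (2 * Real.pi * t))
      linarith
    · have := Real.smoothTransition.monotone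
        (show (1 / 2 : ℝ) ≤ 1 / 2 - -Real.cos (2 * Real.pi * t) by linarith)
      have h1 := Real.smoothTransition.nonneg (1 / 2 - Real.cos (2 * Real.pi * t))
      linarith
  · rintro t ht ⟨k, rfl⟩
    have hcl : IsClosed {t : ℝ | Real.cos (2 * Real.pi * t) ≤ 1 / 2} :=
      isClosed_le hcos.continuous continuous_const
    have hsub : tsupport (fun t => h (Real.cos (2 * Real.pi * t))) ⊆
        {t : ℝ | Real.cos (2 * Real.pi * t) ≤ 1 / 2} := by
      apply closure_minimal _ hcl
      intro s hs
      by_contra hcon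
      simp only [mem_ofPred_eq, not_le] at hcon
      exact hs (Real.smoothTransition.zero_of_nonpos (by linarith))
    have := hsub ht
    simp only [mem_ofPred_eq] at this
    rw [show 2 * Real.pi * (k : ℝ) = k * (2 * Real.pi) by ring, Real.cos_int_mul_two_pi] at this
    norm_num at this

lemma slab_test (d : ℕ) (i : Fin d) : ∃ (a C : ℝ), 0 < a ∧ 0 < C ∧ ∀ N : ℕ, 4 ≤ N →
    ∃ u : EuclideanSpace ℝ (Fin d) → ℝ, ContDiff ℝ (⊤ : ℕ∞) u ∧
    HasCompactSupport u ∧ tsupport u ⊆ slabSet d i N ∧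
    a ≤ (∫ x in slabSet d i N, u x) ∧
    (∫ x in slabSet d i N, ‖fderiv ℝ u x‖ ^ 2) ≤ C * (N : ℝ) ^ 2 := by
  obtain ⟨φ, K, c, hφ, hφ0, hφ1, hK, hc, hφc, hφs⟩ := exists_phi
  let p : EuclideanSpace ℝ (Fin d) := WithLp.toLp 2 (fun _ => 1 / 2)
  let ψ : ContDiffBump p := ⟨1 / 4, 3 / 8, by norm_num, by norm_num⟩
  have hψs : ContDiff ℝ (⊤ : ℕ∞) ψ := ψ.contDiff
  obtain ⟨L, hL⟩ := (ψ.hasCompactSupport.fderiv ℝ).exists_bound_of_continuous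
    (hψs.continuous_fderiv (by simp))
  have hL0 : 0 ≤ L := (norm_nonneg _).trans (hL p)
  have hK0 : 0 ≤ K := (abs_nonneg _).trans (hK 0)
  have hbv : 0 < volume.real (ball p (1 / 8)) :=
    ENNReal.toReal_pos (measure_ball_pos volume p (by norm_num)).ne' measure_ball_lt_top.ne
  refine ⟨c * volume.real (ball p (1 / 8)) / 2, (L + K + 1) ^ 2, by positivity, by positivity, ?_⟩
  intro N hN
  have hN4 : (4 : ℝ) ≤ N := by exact_mod_cast hN
  have hN0 : (0 : ℝ) < N := by linarith
  let l : EuclideanSpace ℝ (Fin d) →L[ℝ] ℝ := EuclideanSpace.proj i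
  let f : EuclideanSpace ℝ (Fin d) → ℝ := fun x => φ ((N : ℝ) * x i)
  have hlin : ∀ x : EuclideanSpace ℝ (Fin d),
      HasFDerivAt (fun x : EuclideanSpace ℝ (Fin d) => (N : ℝ) * x i) ((N : ℝ) • l) x :=
    fun x => (l.hasFDerivAt).const_mul _
  have hlinS : ContDiff ℝ (⊤ : ℕ∞) (fun x : EuclideanSpace ℝ (Fin d) => (N : ℝ) * x i) :=
    contDiff_const.mul l.contDiff
  have hf : ContDiff ℝ (⊤ : ℕ∞) f := hφ.comp hlinS
  have hu : ContDiff ℝ (⊤ : ℕ∞) (fun x => ψ x * f x) := hψs.mul hf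
  have hcs : HasCompactSupport (fun x => ψ x * f x) := ψ.hasCompactSupport.mul_right
  have hts : tsupport (fun x => ψ x * f x) ⊆ slabSet d i N := by
    intro x hx
    constructor
    · intro j
      have h1 : x ∈ tsupport ψ := tsupport_mul_subset_left hx
      rw [ψ.tsupport_eq, mem_closedBall, dist_eq_norm] at h1
      have h2 := (PiLp.norm_apply_le (x - p) j).trans h1
      have h3 : (x - p) j = x j - 1 / 2 := rfl
      rw [h3, Real.norm_eq_abs, abs_le] at h2
      have h4 : ψ.rOut = 3 / 8 := rfl
      rw [h4] at h2
      constructor <;> linarith [h2.1, h2.2]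
    · have h1 : x ∈ tsupport f := tsupport_mul_subset_right hx
      exact hφs _ (tsupport_comp_subset_preimage φ hlinS.continuous h1)
  have hui : Integrable (fun x => ψ x * f x) := hu.continuous.integrable_of_hasCompactSupport hcs
  have hz : ∀ x, x ∉ slabSet d i N → ψ x * f x = 0 := fun x hx =>
    image_eq_zero_of_notMem_tsupport (f := fun x => ψ x * f x) fun h => hx (hts h)
  refine ⟨fun x => ψ x * f x, hu, hcs, hts, ?_, ?_⟩
  · rw [setIntegral_eq_integral_of_forall_compl_eq_zero hz]
    let e : EuclideanSpace ℝ (Fin d) := EuclideanSpace.single i (1 / (2 * N))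
    have hen : ‖e‖ ≤ 1 / 8 := by
      simp only [e, PiLp.norm_single, Real.norm_eq_abs]
      rw [abs_of_pos (by positivity)]
      apply one_div_le_one_div_of_le <;> linarith
    have htr := integral_add_right_eq_self (μ := volume) (fun x => ψ x * f x) e
    have hui' : Integrable (fun x => ψ (x + e) * f (x + e)) := hui.comp_add_right e
    have hmain : ∫ x, (ball p (1 / 8)).indicator (fun _ => c) x ≤
        ∫ x, (ψ x * f x + ψ (x + e) * f (x + e)) := by
      apply integral_mono
      · exact (integrable_indicator_iff measurableSet_ball).2
          (integrableOn_const measure_ball_lt_top.ne)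
      · exact hui.add hui'
      · intro x
        by_cases hx : x ∈ ball p (1 / 8)
        · simp only [indicator_of_mem hx]
          rw [mem_ball] at hx
          have h1 : ψ x = 1 := ψ.one_of_mem_closedBall (by
            rw [mem_closedBall]; change dist x p ≤ 1 / 4; linarith)
          have h2 : ψ (x + e) = 1 := ψ.one_of_mem_closedBall (by
            rw [mem_closedBall]; change dist (x + e) p ≤ 1 / 4
            have := dist_triangle (x + e) x p
            have h3 : dist (x + e) x = ‖e‖ := by simp [dist_eq_norm]
            linarith)
          have h3 : f (x + e) = φ ((N : ℝ) * x i + 1 / 2) := by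
            simp only [f]
            congr 1
            simp [e]
            field_simp
          rw [h1, h2, h3, one_mul, one_mul]
          exact hφc _
        · simp only [indicator_of_notMem hx]
          have := mul_nonneg (ψ.nonneg' x) (hφ0 ((N : ℝ) * x i))
          have := mul_nonneg (ψ.nonneg' (x + e)) (hφ0 ((N : ℝ) * (x + e) i))
          simp only [f]
          linarith
    rw [integral_indicator measurableSet_ball, setIntegral_const, integral_add hui hui', htr,
      smul_eq_mul] at hmain
    linarith
  · have hpt : ∀ x, ‖fderiv ℝ (fun x => ψ x * f x) x‖ ^ 2 ≤ (L + K + 1) ^ 2 * (N : ℝ) ^ 2 := by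
      intro x
      rw [← mul_pow]
      apply pow_le_pow_left₀ (norm_nonneg _)
      have hfd : HasFDerivAt f (deriv φ ((N : ℝ) * x i) • ((N : ℝ) • l)) x :=
        ((hφ.differentiable (by simp) _).hasDerivAt).comp_hasFDerivAt x (hlin x)
      have hψd := (hψs.differentiable (by simp) x).hasFDerivAt
      have hfe : fderiv ℝ (fun x => ψ x * f x) x = _ := (hψd.mul hfd).fderiv
      rw [hfe]
      have hl : ‖l‖ ≤ 1 := by
        apply ContinuousLinearMap.opNorm_le_bound _ zero_le_one
        intro y
        rw [one_mul]
        exact PiLp.norm_apply_le y i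
      have h1 : ‖ψ x‖ ≤ 1 := by
        rw [Real.norm_eq_abs, abs_of_nonneg ψ.nonneg]; exact ψ.le_one
      have h2 : ‖f x‖ ≤ 1 := by
        rw [Real.norm_eq_abs, abs_of_nonneg (hφ0 _)]; exact hφ1 _
      have h3 : ‖deriv φ ((N : ℝ) * x i)‖ ≤ K := hK _
      have h4 : ‖(N : ℝ)‖ = N := by simp
      calc _ ≤ ‖ψ x‖ * (‖deriv φ ((N : ℝ) * x i)‖ * (‖(N : ℝ)‖ * ‖l‖)) + ‖f x‖ * ‖fderiv ℝ ψ x‖ := by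
            refine (norm_add_le _ _).trans ?_
            rw [norm_smul, norm_smul, norm_smul, norm_smul]
        _ ≤ 1 * (K * (N * 1)) + 1 * L := by
            rw [h4]
            gcongr
            exact hL x
        _ ≤ _ := by nlinarith
    have hp : IsProbabilityMeasure (volume.restrict (slabSet d i N)) :=
      ⟨by rw [Measure.restrict_apply_univ, slab_volume d i N (by omega)]⟩
    calc _ ≤ ∫ x in slabSet d i N, (L + K + 1) ^ 2 * (N : ℝ) ^ 2 := by
          apply integral_mono_of_nonneg
          · exact Filter.Eventually.of_forall fun x => by positivity
          · exact integrable_const _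
          · exact Filter.Eventually.of_forall hpt
      _ = _ := by simp

theorem dirichlet_sup_infinite_of_q_lt_one (d : ℕ) (hd : 1 ≤ d) (q : ℝ)
    (hq0 : 0 < q) (hq1 : q < 1) :
    ∀ M : ℝ, 0 < M → ∃ Ω : Set (EuclideanSpace ℝ (Fin d)),
      Ω.Nonempty ∧ IsOpen Ω ∧ Bornology.IsBounded Ω ∧ volume Ω = 1 ∧
      M ≤ dirichletEigenvalue d Ω * dirichletTorsion d Ω ^ q := by
  intro M hM
  let i : Fin d := ⟨0, hd⟩
  obtain ⟨a, C, ha, hC, hex⟩ := slab_test d i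
  have hb : 0 < (a ^ 2 / C) ^ q / 4 := by positivity
  have hlim : Filter.Tendsto (fun N : ℕ => (N : ℝ) ^ (2 - 2 * q)) Filter.atTop Filter.atTop :=
    (tendsto_rpow_atTop (by linarith)).comp tendsto_natCast_atTop_atTop
  obtain ⟨N, hNM, hN⟩ := ((hlim.eventually_ge_atTop (M / ((a ^ 2 / C) ^ q / 4))).and
    (Filter.eventually_ge_atTop 4)).exists
  have hN1 : 0 < N := by omega
  have hN0 : (0 : ℝ) < N := by positivity
  obtain ⟨u, hu, hcs, hts, hint, hgrad⟩ := hex N hN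
  have hvol := slab_volume d i N hN1
  refine ⟨slabSet d i N, ?_, slab_open d i N, slab_bounded d i N, hvol, ?_⟩
  · apply nonempty_of_measure_ne_zero (μ := volume)
    rw [hvol]; exact one_ne_zero
  have hP := slab_poincare d i N hN1
  have hCS := slab_cs d i N hN1
  have hsq : a ^ 2 ≤ (∫ x in slabSet d i N, u x) ^ 2 := pow_le_pow_left₀ ha.le hint 2
  have hu2 : 0 < ∫ x in slabSet d i N, u x ^ 2 := by
    have := hCS u hu hcs
    have : 0 < a ^ 2 := by positivity
    linarith
  have hD : 0 < ∫ x in slabSet d i N, ‖fderiv ℝ u x‖ ^ 2 := by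
    have := hP u hu hcs hts
    exact pos_of_mul_pos_right (hu2.trans_le this) (by positivity)
  have hlam : (N : ℝ) ^ 2 / 4 ≤ dirichletEigenvalue d (slabSet d i N) := by
    apply le_csInf
    · exact ⟨_, u, hu, hcs, hts, hu2, rfl⟩
    · rintro t ⟨w, hw, hwc, hws, hw2, rfl⟩
      rw [le_div_iff₀ hw2]
      have := hP w hw hwc hws
      calc _ ≤ (N : ℝ) ^ 2 / 4 * _ := mul_le_mul_of_nonneg_left this (by positivity)
        _ = _ := by field_simp
  have hT : a ^ 2 / C / (N : ℝ) ^ 2 ≤ dirichletTorsion d (slabSet d i N) := by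
    have h1 : (∫ x in slabSet d i N, u x) ^ 2 / (∫ x in slabSet d i N, ‖fderiv ℝ u x‖ ^ 2) ≤
        dirichletTorsion d (slabSet d i N) := by
      apply le_csSup
      · refine ⟨4 / (N : ℝ) ^ 2, ?_⟩
        rintro t ⟨w, hw, hwc, hws, hw2, rfl⟩
        rw [div_le_iff₀ hw2]
        exact (hCS w hw hwc).trans (hP w hw hwc hws)
      · exact ⟨u, hu, hcs, hts, hD, rfl⟩
    refine le_trans ?_ h1
    rw [div_div]
    gcongr
  have hNe : (N : ℝ) ^ (2 - 2 * q) = (N : ℝ) ^ 2 / ((N : ℝ) ^ 2) ^ q := by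
    rw [Real.rpow_sub hN0, Real.rpow_mul hN0.le, Real.rpow_two]
  calc M ≤ (N : ℝ) ^ (2 - 2 * q) * ((a ^ 2 / C) ^ q / 4) := (div_le_iff₀ hb).1 hNM
    _ = (N : ℝ) ^ 2 / 4 * (a ^ 2 / C / (N : ℝ) ^ 2) ^ q := by
        rw [hNe, Real.div_rpow (x := a ^ 2 / C) (y := (N : ℝ) ^ 2) (by positivity) (by positivity)]
        ring
    _ ≤ _ := by
        gcongr
        exact (by positivity : (0 : ℝ) ≤ (N : ℝ) ^ 2 / 4).trans hlam
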